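/- arXiv:1107.1691 — 7 statements merged into one kernel-verified Lean document; each statement's English description precedes it below -/
import Mathlib

section
/- Let m, ℏ, ω > 0 be real constants, let s : ℝ → ℝ be continuous, and let a : ℝ → ℝ be twice continuously differentiable and satisfy a''(t) + ω²(a(t) − s(t)) = 0 for all t. Let Ψ : ℝ → ℂ be twice differentiable and E ∈ ℝ be such that −(ℏ²/(2m))·Ψ''(x) + (m ω²/2)·x²·Ψ(x) = E·Ψ(x) for all x ∈ ℝ. Define φ(t) = −(1/ℏ)·(E·t + (m/2)·∫₀ᵗ (a'(σ)² + ω²(s(σ)² − a(σ)²)) dσ) and ψ(x,t) = exp(i·((m·a'(t)/ℏ)·x + φ(t)))·Ψ(x − a(t)). Then ψ satisfies the time-dependent Schrödinger equation with moving harmonic potential: i·ℏ·∂ψ/∂t(x,t) = −(ℏ²/(2m))·∂²ψ/∂x²(x,t) + (m ω²/2)·(x − s(t))²·ψ(x,t) for all x, t ∈ ℝ. -/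
open Real Complex intervalIntegral

/-- The second derivative of a plane wave times a twice differentiable function. -/
theorem deriv_deriv_planeWave_mul {f : ℝ → ℂ} (hf : Differentiable ℝ f)
    (hf' : Differentiable ℝ (deriv f)) (k c b x : ℝ) :
    deriv (deriv fun ξ : ℝ => Complex.exp (Complex.I * ((k * ξ + c : ℝ) : ℂ)) * f (ξ - b)) x
      = Complex.exp (Complex.I * ((k * x + c : ℝ) : ℂ))
        * (deriv (deriv f) (x - b) + 2 * Complex.I * k * deriv f (x - b)
          - (k : ℂ) ^ 2 * f (x - b)) := by
  have hexp (y : ℝ) : HasDerivAt (fun ξ : ℝ => Complex.exp (Complex.I * ((k * ξ + c : ℝ) : ℂ)))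
      (Complex.exp (Complex.I * ((k * y + c : ℝ) : ℂ)) * (Complex.I * k)) y := by
    have h : HasDerivAt (fun ξ : ℝ => k * ξ + c) k y := by
      simpa using ((hasDerivAt_id y).const_mul k).add_const c
    exact (h.ofReal_comp.const_mul Complex.I).cexp
  have hshift {g : ℝ → ℂ} (hg : Differentiable ℝ g) (y : ℝ) :
      HasDerivAt (fun ξ : ℝ => g (ξ - b)) (deriv g (y - b)) y :=
    (hg (y - b)).hasDerivAt.comp_sub_const y b
  rw [funext fun y => ((hexp y).fun_mul (hshift hf y)).deriv]
  refine ((((hexp x).mul_const (Complex.I * k)).fun_mul (hshift hf x)).fun_add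
    ((hexp x).fun_mul (hshift hf' x))).deriv.trans ?_
  linear_combination Complex.exp (Complex.I * ((k * x + c : ℝ) : ℂ)) * (k : ℂ) ^ 2 * f (x - b)
    * Complex.I_sq

/-- If `a` solves `a'' + ω²(a − s) = 0`, `Ψ` is an eigenfunction of the static harmonic
oscillator with energy `E`, and `φ`, `ψ` are defined by the Leach ansatz, then `ψ` solves
the time-dependent Schrödinger equation with moving harmonic potential centered at `s(t)`. -/
theorem moving_trap_ansatz_solves_schrodinger
    (m ℏ ω : ℝ) (hm : 0 < m) (hℏ : 0 < ℏ) (hω : 0 < ω)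
    (s a : ℝ → ℝ) (hs : Continuous s) (ha : ContDiff ℝ 2 a)
    (hode : ∀ t : ℝ, deriv (deriv a) t + ω ^ 2 * (a t - s t) = 0)
    (Ψ : ℝ → ℂ) (hΨ₁ : Differentiable ℝ Ψ) (hΨ₂ : Differentiable ℝ (deriv Ψ))
    (E : ℝ)
    (heig : ∀ x : ℝ,
      -((ℏ : ℂ) ^ 2 / (2 * (m : ℂ))) * deriv (deriv Ψ) x
        + ((m : ℂ) * (ω : ℂ) ^ 2 / 2) * (x : ℂ) ^ 2 * Ψ x = (E : ℂ) * Ψ x)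
    (φ : ℝ → ℝ)
    (hφ : ∀ t : ℝ, φ t = -(1 / ℏ) * (E * t
      + (m / 2) * ∫ σ in (0 : ℝ)..t, ((deriv a σ) ^ 2 + ω ^ 2 * ((s σ) ^ 2 - (a σ) ^ 2))))
    (ψ : ℝ → ℝ → ℂ)
    (hψ : ∀ x t : ℝ, ψ x t
      = Complex.exp (Complex.I * ((m * deriv a t / ℏ * x + φ t : ℝ) : ℂ))
        * Ψ (x - a t)) :
    ∀ x t : ℝ,
      Complex.I * (ℏ : ℂ) * deriv (fun τ : ℝ => ψ x τ) t
        = -((ℏ : ℂ) ^ 2 / (2 * (m : ℂ))) * deriv (deriv (fun ξ : ℝ => ψ ξ t)) x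
          + ((m : ℂ) * (ω : ℂ) ^ 2 / 2) * ((x : ℂ) - (s t : ℂ)) ^ 2 * ψ x t := by
  intro x t
  have hda : ContDiff ℝ 1 (deriv a) := ha.deriv'
  have hat : HasDerivAt a (deriv a t) t :=
    (ha.differentiable (by norm_num) t).hasDerivAt
  have hat' : HasDerivAt (deriv a) (-ω ^ 2 * (a t - s t)) t := by
    have h : deriv (deriv a) t = -ω ^ 2 * (a t - s t) := by linear_combination hode t
    exact h ▸ (hda.differentiable one_ne_zero t).hasDerivAt
  have hcont : Continuous fun σ => deriv a σ ^ 2 + ω ^ 2 * (s σ ^ 2 - a σ ^ 2) := by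
    have := hda.continuous
    have := ha.continuous
    fun_prop
  have hφt : HasDerivAt φ
      (-(1 / ℏ) * (E + (m / 2) * (deriv a t ^ 2 + ω ^ 2 * (s t ^ 2 - a t ^ 2)))) t := by
    rw [funext hφ]
    have hlin : HasDerivAt (fun τ : ℝ => E * τ) E t := by
      simpa using (hasDerivAt_id t).const_mul E
    exact (hlin.fun_add ((hcont.integral_hasStrictDerivAt 0 t).hasDerivAt.const_mul
      (m / 2))).const_mul (-(1 / ℏ))
  have hphase := ((((hat'.const_mul m).div_const ℏ).mul_const x).fun_add hφt).ofReal_comp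
  have hΨt : HasDerivAt (fun τ => Ψ (x - a τ)) ((-deriv a t) • deriv Ψ (x - a t)) t :=
    (hΨ₁ (x - a t)).hasDerivAt.scomp t (hat.const_sub x)
  have hψt := ((hphase.const_mul Complex.I).cexp.fun_mul hΨt).deriv
  have hm' : (m : ℂ) ≠ 0 := mod_cast hm.ne'
  have hℏ' : (ℏ : ℂ) ≠ 0 := mod_cast hℏ.ne'
  simp only [hψ]
  rw [hψt, deriv_deriv_planeWave_mul hΨ₁ hΨ₂]
  have heig' := heig (x - a t)
  rw [Complex.real_smul]
  generalize Complex.exp _ = e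
  push_cast at heig' ⊢
  field_simp at heig' ⊢
  linear_combination -e * heig' - m * e * Ψ (x - a t) * (2 * E + m * deriv a t ^ 2
    + m * ω ^ 2 * (2 * x * (a t - s t) + s t ^ 2 - a t ^ 2)) * Complex.I_sq
end

section
/- Let ρ ≥ 1 be an integer and let α, β, δ ∈ (0, 2π) be real numbers satisfying (2ρ − exp(i·α))·exp(i·δ) = 2ρ − exp(−i·β) (equivalently exp(i·δ) = (2ρ − exp(−i·β))/(2ρ − exp(i·α)), the denominator being nonzero). Then α = β, and exp(i·δ) = exp(2·i·φ) where φ = arctan(sin α/(2ρ − cos α)). -/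
open Real Complex

/-- For `D ≠ 0` the unit complex number `e^{2i arctan(s / D)}` equals `(D + is) / (D - is)`. -/
theorem sub_mul_exp_two_mul_arctan_div {D : ℝ} (hD : D ≠ 0) (s : ℝ) :
    ((D : ℂ) - I * s) * Complex.exp (2 * I * ((Real.arctan (s / D) : ℝ) : ℂ)) = D + I * s := by
  set φ := Real.arctan (s / D) with hφ
  have hc : Real.cos φ ≠ 0 := (Real.cos_arctan_pos _).ne'
  have htan : D * Real.sin φ = s * Real.cos φ := by
    have h : Real.sin φ / Real.cos φ = s / D := by
      rw [← Real.tan_eq_sin_div_cos, hφ, Real.tan_arctan]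
    rw [div_eq_div_iff hc hD] at h
    linarith
  have hsq := Real.sin_sq_add_cos_sq φ
  have hexp : Complex.exp (2 * I * (φ : ℂ))
      = ((Real.cos φ : ℂ) + (Real.sin φ : ℂ) * I) ^ 2 := by
    rw [ofReal_cos, ofReal_sin, ← Complex.exp_mul_I, ← Complex.exp_nat_mul]
    congr 1
    push_cast
    ring
  rw [hexp]
  have htan' : (D : ℂ) * (Real.sin φ : ℂ) = s * (Real.cos φ : ℂ) := by exact_mod_cast htan
  have hsq' : (Real.sin φ : ℂ) ^ 2 + (Real.cos φ : ℂ) ^ 2 = 1 := by exact_mod_cast hsq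
  have hc' : (Real.cos φ : ℂ) ≠ 0 := by exact_mod_cast hc
  apply mul_right_cancel₀ hc'
  generalize (Real.cos φ : ℂ) = c at *
  generalize (Real.sin φ : ℂ) = σ at *
  linear_combination (I * (c + σ * I) ^ 2 + I) * htan' + D * (c + σ * I) * hsq'
    - D * (c + σ * I) * σ ^ 2 * I_sq

/-- Two angles of `(0, 2π)` with the same cosine are equal or symmetric about `π`. -/
theorem eq_or_eq_two_pi_sub_of_cos_eq {α β : ℝ} (hα : α ∈ Set.Ioo (0 : ℝ) (2 * π))
    (hβ : β ∈ Set.Ioo (0 : ℝ) (2 * π)) (h : Real.cos α = Real.cos β) :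
    α = β ∨ β = 2 * π - α := by
  obtain ⟨hα₀, hα₁⟩ := hα
  obtain ⟨hβ₀, hβ₁⟩ := hβ
  have hπ := Real.pi_pos
  obtain ⟨k, hk | hk⟩ := Real.cos_eq_cos_iff.1 h
  · have h₁ : (k : ℝ) < 1 := by nlinarith
    have h₂ : (-1 : ℝ) < k := by nlinarith
    have hk₀ : k = 0 := by
      have : k < 1 := by exact_mod_cast h₁
      have : -1 < k := by exact_mod_cast h₂
      omega
    left
    simp [hk, hk₀]
  · have h₁ : (k : ℝ) < 2 := by nlinarith
    have h₂ : (0 : ℝ) < k := by nlinarith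
    have hk₁ : k = 1 := by
      have : k < 2 := by exact_mod_cast h₁
      have : 0 < k := by exact_mod_cast h₂
      omega
    right
    simp [hk, hk₁]

/-- If `α, β, δ ∈ (0, 2π)` satisfy `(2ρ − e^{iα}) e^{iδ} = 2ρ − e^{−iβ}`, then `α = β` and
`e^{iδ} = e^{2iφ}` with `φ = arctan(sin α / (2ρ − cos α))`. -/
theorem interval_equation_first_eq_last
    (ρ : ℕ) (hρ : 1 ≤ ρ) (α β δ : ℝ)
    (hα : α ∈ Set.Ioo (0 : ℝ) (2 * π))
    (hβ : β ∈ Set.Ioo (0 : ℝ) (2 * π))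
    (hδ : δ ∈ Set.Ioo (0 : ℝ) (2 * π))
    (heq : ((2 * (ρ : ℂ)) - Complex.exp (Complex.I * (α : ℂ))) * Complex.exp (Complex.I * (δ : ℂ))
      = (2 * (ρ : ℂ)) - Complex.exp (-(Complex.I * (β : ℂ)))) :
    α = β ∧
    Complex.exp (Complex.I * (δ : ℂ))
      = Complex.exp (2 * Complex.I *
          ((Real.arctan (Real.sin α / (2 * (ρ : ℝ) - Real.cos α)) : ℝ) : ℂ)) := by
  have hπ := Real.pi_pos
  have hρ' : (1 : ℝ) ≤ ρ := by exact_mod_cast hρ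
  have hD : 0 < 2 * (ρ : ℝ) - Real.cos α := by linarith [Real.cos_le_one α]
  have hexp (x : ℝ) : Complex.exp (I * x) = (Real.cos x : ℂ) + I * (Real.sin x : ℂ) := by
    rw [mul_comm, Complex.exp_mul_I, ofReal_cos, ofReal_sin, mul_comm I]
  have hexp_neg : Complex.exp (-(I * (β : ℂ))) = (Real.cos β : ℂ) - I * (Real.sin β : ℂ) := by
    have h := hexp (-β)
    simp only [ofReal_neg, Real.cos_neg, Real.sin_neg, mul_neg] at h
    rw [h, sub_eq_add_neg]
  have hα' : 2 * (ρ : ℂ) - Complex.exp (I * (α : ℂ))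
      = ((2 * (ρ : ℝ) - Real.cos α : ℝ) : ℂ) - I * (Real.sin α : ℂ) := by
    rw [hexp]
    push_cast
    ring
  have hne : 2 * (ρ : ℂ) - Complex.exp (I * (α : ℂ)) ≠ 0 := by
    intro h
    rw [hα'] at h
    have := congrArg Complex.re h
    simp only [sub_re, mul_re, I_re, I_im, ofReal_re, ofReal_im, zero_re] at this
    linarith
  have hcos : Real.cos α = Real.cos β := by
    have h := heq
    rw [hα', hexp_neg, hexp δ] at h
    have hre := congrArg Complex.re h
    have him := congrArg Complex.im h
    simp at hre him
    simp only [← ofReal_cos, ← ofReal_sin, ofReal_re] at hre him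
    have hα₂ := Real.sin_sq_add_cos_sq α
    have hβ₂ := Real.sin_sq_add_cos_sq β
    have hδ₂ := Real.sin_sq_add_cos_sq δ
    have h₀ : 4 * (ρ : ℝ) * (Real.cos α - Real.cos β) = 0 := by
      linear_combination
        -((2 * (ρ : ℝ) - Real.cos α) * Real.cos δ + Real.sin α * Real.sin δ
            + (2 * (ρ : ℝ) - Real.cos β)) * hre
          - ((2 * (ρ : ℝ) - Real.cos α) * Real.sin δ - Real.sin α * Real.cos δ
            + Real.sin β) * him
          - hβ₂ + ((2 * (ρ : ℝ) - Real.cos α) ^ 2 + Real.sin α ^ 2) * hδ₂ + hα₂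
    exact sub_eq_zero.1 ((mul_eq_zero.1 h₀).resolve_left (by positivity))
  have hαβ : α = β := by
    refine (eq_or_eq_two_pi_sub_of_cos_eq hα hβ hcos).resolve_right fun hsymm => ?_
    have hβα : Complex.exp (-(I * (β : ℂ))) = Complex.exp (I * (α : ℂ)) := by
      rw [hexp_neg, hexp, ← hcos, hsymm, Real.sin_two_pi_sub]
      push_cast
      ring
    rw [hβα] at heq
    have h₁ : Complex.exp (I * (δ : ℂ)) = 1 := mul_left_cancel₀ hne (by rw [heq, mul_one])
    have h₂ : Real.cos δ = 1 := by
      have := congrArg Complex.re h₁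
      rw [hexp] at this
      simpa [← ofReal_cos, ← ofReal_sin] using this
    rw [Real.cos_eq_one_iff_of_lt_of_lt (by linarith [hδ.1]) hδ.2] at h₂
    exact hδ.1.ne' h₂
  refine ⟨hαβ, mul_left_cancel₀ hne ?_⟩
  rw [heq, hα', sub_mul_exp_two_mul_arctan_div hD.ne', hexp_neg, ← hαβ]
  push_cast
  ring
end

section
/- For every integer ρ ≥ 1, the function h(τ) = τ/(2ρ − 1) − arctan(sin τ/(2ρ − cos τ)) is strictly increasing on the interval [0, 2π]; indeed its derivative h'(τ) = 1/(2ρ − 1) − (2ρ·cos τ − 1)/(4ρ² − 4ρ·cos τ + 1) is strictly positive for every τ ∈ (0, 2π) and vanishes only at τ = 0 and τ = 2π. -/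
open Real

theorem sq_sub_two_mul_cos_add_one_pos {a : ℝ} (ha : 1 < a) (τ : ℝ) :
    0 < a ^ 2 - 2 * a * cos τ + 1 := by
  nlinarith [cos_le_one τ, mul_pos (sub_pos.2 ha) (sub_pos.2 ha)]

theorem one_div_sub_cos_quotient_eq {a : ℝ} (ha : 1 < a) (τ : ℝ) :
    1 / (a - 1) - (a * cos τ - 1) / (a ^ 2 - 2 * a * cos τ + 1)
      = a * (a + 1) * (1 - cos τ) / ((a - 1) * (a ^ 2 - 2 * a * cos τ + 1)) := by
  have h₁ : a - 1 ≠ 0 := (sub_pos.2 ha).ne'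
  have h₂ := (sq_sub_two_mul_cos_add_one_pos ha τ).ne'
  rw [div_sub_div _ _ h₁ h₂]
  congr 1
  ring

theorem hasDerivAt_arctan_sin_div_sub_cos {a : ℝ} (ha : 1 < a) (τ : ℝ) :
    HasDerivAt (fun τ : ℝ => arctan (sin τ / (a - cos τ)))
      ((a * cos τ - 1) / (a ^ 2 - 2 * a * cos τ + 1)) τ := by
  have h₁ : a - cos τ ≠ 0 := by linarith [cos_le_one τ]
  have h₂ := (sq_sub_two_mul_cos_add_one_pos ha τ).ne'
  have h₃ : (a - cos τ) ^ 2 + sin τ ^ 2 = a ^ 2 - 2 * a * cos τ + 1 := by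
    linear_combination sin_sq_add_cos_sq τ
  have h₄ : cos τ * (a - cos τ) - sin τ * -(-sin τ) = a * cos τ - 1 := by
    linear_combination -sin_sq_add_cos_sq τ
  have h₅ : 1 + (sin τ / (a - cos τ)) ^ 2
      = (a ^ 2 - 2 * a * cos τ + 1) / (a - cos τ) ^ 2 := by
    rw [← h₃]
    field_simp
  refine ((hasDerivAt_sin τ).div ((hasDerivAt_cos τ).const_sub a) h₁).arctan.congr_deriv ?_
  rw [h₄, Pi.div_apply, h₅]
  field_simp

/-- The function `h(τ) = τ/(2ρ−1) − arctan(sin τ/(2ρ − cos τ))` is strictly increasing on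
`[0, 2π]`; its derivative `h'(τ) = 1/(2ρ−1) − (2ρ cos τ − 1)/(4ρ² − 4ρ cos τ + 1)` is strictly
positive on `(0, 2π)` and vanishes at the endpoints `τ = 0` and `τ = 2π`. -/
theorem h_strictMono_and_deriv_pos (ρ : ℕ) (hρ : 1 ≤ ρ) :
    StrictMonoOn
      (fun τ : ℝ => τ / (2 * (ρ : ℝ) - 1)
        - Real.arctan (Real.sin τ / (2 * (ρ : ℝ) - Real.cos τ)))
      (Set.Icc 0 (2 * π)) ∧
    (∀ τ : ℝ, HasDerivAt
      (fun τ : ℝ => τ / (2 * (ρ : ℝ) - 1)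
        - Real.arctan (Real.sin τ / (2 * (ρ : ℝ) - Real.cos τ)))
      (1 / (2 * (ρ : ℝ) - 1)
        - (2 * (ρ : ℝ) * Real.cos τ - 1) / (4 * (ρ : ℝ) ^ 2 - 4 * (ρ : ℝ) * Real.cos τ + 1))
      τ) ∧
    (∀ τ ∈ Set.Ioo (0 : ℝ) (2 * π),
      0 < 1 / (2 * (ρ : ℝ) - 1)
        - (2 * (ρ : ℝ) * Real.cos τ - 1) / (4 * (ρ : ℝ) ^ 2 - 4 * (ρ : ℝ) * Real.cos τ + 1)) ∧
    (1 / (2 * (ρ : ℝ) - 1)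
      - (2 * (ρ : ℝ) * Real.cos 0 - 1) / (4 * (ρ : ℝ) ^ 2 - 4 * (ρ : ℝ) * Real.cos 0 + 1) = 0) ∧
    (1 / (2 * (ρ : ℝ) - 1)
      - (2 * (ρ : ℝ) * Real.cos (2 * π) - 1)
        / (4 * (ρ : ℝ) ^ 2 - 4 * (ρ : ℝ) * Real.cos (2 * π) + 1) = 0) := by
  have ha : (1 : ℝ) < 2 * ρ := by
    have : (1 : ℝ) ≤ ρ := by exact_mod_cast hρ
    linarith
  have hD (τ : ℝ) : 4 * (ρ : ℝ) ^ 2 - 4 * ρ * cos τ + 1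
      = (2 * (ρ : ℝ)) ^ 2 - 2 * (2 * ρ) * cos τ + 1 := by ring
  simp only [hD]
  have hderiv (τ : ℝ) := ((hasDerivAt_id' τ).div_const (2 * (ρ : ℝ) - 1)).sub
    (hasDerivAt_arctan_sin_div_sub_cos ha τ)
  have hpos : ∀ τ ∈ Set.Ioo (0 : ℝ) (2 * π),
      0 < 1 / (2 * (ρ : ℝ) - 1) - (2 * (ρ : ℝ) * cos τ - 1)
        / ((2 * (ρ : ℝ)) ^ 2 - 2 * (2 * ρ) * cos τ + 1) := by
    intro τ hτ
    have hcos : cos τ < 1 := (cos_le_one τ).lt_of_ne fun h =>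
      hτ.1.ne' ((cos_eq_one_iff_of_lt_of_lt (by linarith [hτ.1, pi_pos]) hτ.2).1 h)
    rw [one_div_sub_cos_quotient_eq ha]
    have := sq_sub_two_mul_cos_add_one_pos ha τ
    have := sub_pos.2 ha
    have := sub_pos.2 hcos
    positivity
  refine ⟨?_, hderiv, hpos, ?_, ?_⟩
  · refine strictMonoOn_of_deriv_pos (convex_Icc _ _)
      (fun τ _ => (hderiv τ).continuousAt.continuousWithinAt) fun τ hτ => ?_
    rw [interior_Icc] at hτ
    exact (hpos τ hτ).trans_eq (hderiv τ).deriv.symm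
  · rw [one_div_sub_cos_quotient_eq ha]
    simp
  · rw [one_div_sub_cos_quotient_eq ha]
    simp
end

section
/- Let ρ ≥ 1 be an integer and γ > 0 a real number. Then for every τ ∈ [0, 2π), g_ρ(τ) = (2τ + 2(ρ − 1)π + γ)/(2ρ − 1) − 2·arctan(sin τ/(2ρ − cos τ)) > 0; in particular the equation g_ρ(τ) = 0 has no solution in (0, π). -/
open Real

/-- The arctangent lies below the identity on the nonnegative half-line. -/
theorem arctan_le_self_of_nonneg {x : ℝ} (hx : 0 ≤ x) : Real.arctan x ≤ x := by
  simpa only [Real.tan_arctan] using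
    Real.le_tan (Real.arctan_nonneg.2 hx) (Real.arctan_lt_pi_div_two x)

/-- For `1 ≤ r`, the expression `(2τ + 2(r−1)π + γ)/(2r−1) − 2 arctan(sin τ/(2r − cos τ))`
is positive for all `τ ≥ 0` and `γ > 0`. -/
theorem sub_two_arctan_sin_div_pos {r γ τ : ℝ} (hr : 1 ≤ r) (hγ : 0 < γ) (hτ : 0 ≤ τ) :
    0 < (2 * τ + 2 * (r - 1) * π + γ) / (2 * r - 1)
      - 2 * Real.arctan (Real.sin τ / (2 * r - Real.cos τ)) := by
  have hd : 0 < 2 * r - 1 := by linarith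
  have harctan : Real.arctan (Real.sin τ / (2 * r - Real.cos τ)) ≤ τ / (2 * r - 1) :=
    (Real.arctan_mono (div_le_div₀ hτ (Real.sin_le hτ) hd
      (by linarith [Real.cos_le_one τ]))).trans (arctan_le_self_of_nonneg (by positivity))
  have hpi : 0 ≤ (r - 1) * π := mul_nonneg (by linarith) Real.pi_pos.le
  have hlt : 2 * (τ / (2 * r - 1)) < (2 * τ + 2 * (r - 1) * π + γ) / (2 * r - 1) := by
    rw [← mul_div_assoc]
    exact div_lt_div_of_pos_right (by linarith) hd
  linarith

/-- For `γ > 0` the function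
`g_ρ(τ) = (2τ + 2(ρ−1)π + γ)/(2ρ−1) − 2 arctan(sin τ/(2ρ − cos τ))` is positive on `[0, 2π)`;
in particular `g_ρ(τ) = 0` has no solution in `(0, π)`. -/
theorem g_positive_no_solution
    (ρ : ℕ) (hρ : 1 ≤ ρ) (γ : ℝ) (hγ : 0 < γ) :
    (∀ τ ∈ Set.Ico (0 : ℝ) (2 * π),
      0 < (2 * τ + 2 * ((ρ : ℝ) - 1) * π + γ) / (2 * (ρ : ℝ) - 1)
        - 2 * Real.arctan (Real.sin τ / (2 * (ρ : ℝ) - Real.cos τ))) ∧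
    ¬ ∃ τ ∈ Set.Ioo (0 : ℝ) π,
      (2 * τ + 2 * ((ρ : ℝ) - 1) * π + γ) / (2 * (ρ : ℝ) - 1)
        - 2 * Real.arctan (Real.sin τ / (2 * (ρ : ℝ) - Real.cos τ)) = 0 := by
  have hr : (1 : ℝ) ≤ ρ := by exact_mod_cast hρ
  refine ⟨fun τ hτ => sub_two_arctan_sin_div_pos hr hγ hτ.1, ?_⟩
  rintro ⟨τ, hτ, h⟩
  exact (sub_two_arctan_sin_div_pos hr hγ hτ.1.le).ne' h
end

section
/- For every real γ > 0 there exist a time T > 0, an integer n ≥ 1, a partition 0 = t₀ < t₁ < ⋯ < tₙ = T, and a function x = (x₁,x₂,x₃) : [0,T] → ℝ³, continuous with x(0) = (0,0,0), such that on each open interval (t_{j−1}, t_j) the functions are differentiable and satisfy x₁' = x₂, x₂' = x₃ − x₁, x₃' = (−1)^{j−1}, and x(T) = (γ, 0, γ). That is, a piecewise-constant control taking values in {−1, 1} suffices to transfer the system from the origin to (γ, 0, γ). -/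
open Real

/-- Left of the delay, a delayed function has derivative zero. -/
lemma hasDerivAt_comp_max_sub_of_lt (F : ℝ → ℝ) {a t : ℝ} (h : t < a) :
    HasDerivAt (fun t => F (max (t - a) 0)) 0 t := by
  refine (hasDerivAt_const t (F 0)).congr_of_eventuallyEq ?_
  filter_upwards [Iio_mem_nhds h] with y hy
  rw [max_eq_right (sub_nonpos.2 (Set.mem_Iio.1 hy).le)]

/-- Right of the delay, a delayed function has the delayed derivative. -/
lemma hasDerivAt_comp_max_sub_of_gt {F : ℝ → ℝ} {a t F' : ℝ} (h : a < t)
    (hF : HasDerivAt F F' (t - a)) :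
    HasDerivAt (fun t => F (max (t - a) 0)) F' t := by
  refine (hF.comp_sub_const t a).congr_of_eventuallyEq ?_
  filter_upwards [Ioi_mem_nhds h] with y hy
  rw [max_eq_left (sub_nonneg.2 (Set.mem_Ioi.1 hy).le)]

/-- The response to the control `1` on `[0, a)`, `-1` on `[a, c)`, `1` afterwards, when the
response to the constant control `1` is `F`. -/
noncomputable def twoSwitchResponse (F : ℝ → ℝ) (a c t : ℝ) : ℝ :=
  F t - 2 * F (max (t - a) 0) + 2 * F (max (t - c) 0)

lemma continuous_twoSwitchResponse {F : ℝ → ℝ} (hF : Continuous F) (a c : ℝ) :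
    Continuous (twoSwitchResponse F a c) := by
  unfold twoSwitchResponse
  fun_prop

lemma hasDerivAt_twoSwitchResponse_of_hasDerivAt {F : ℝ → ℝ} {a c t f p q : ℝ}
    (hF : HasDerivAt F f t) (ha : HasDerivAt (fun t => F (max (t - a) 0)) p t)
    (hc : HasDerivAt (fun t => F (max (t - c) 0)) q t) :
    HasDerivAt (twoSwitchResponse F a c) (f - 2 * p + 2 * q) t :=
  (hF.sub (ha.const_mul 2)).add (hc.const_mul 2)

/-- Away from the switching times, differentiation commutes with `twoSwitchResponse` when the
derivative vanishes at the origin. -/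
lemma hasDerivAt_twoSwitchResponse {F G : ℝ → ℝ} (hF : ∀ t, HasDerivAt F (G t) t)
    (hG : G 0 = 0) {a c t : ℝ} (ha : t ≠ a) (hc : t ≠ c) :
    HasDerivAt (twoSwitchResponse F a c) (twoSwitchResponse G a c t) t := by
  have key (b : ℝ) (hb : t ≠ b) :
      HasDerivAt (fun t => F (max (t - b) 0)) (G (max (t - b) 0)) t := by
    rcases hb.lt_or_gt with h | h
    · rw [max_eq_right (sub_nonpos.2 h.le), hG]
      exact hasDerivAt_comp_max_sub_of_lt F h
    · rw [max_eq_left (sub_nonneg.2 h.le)]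
      exact hasDerivAt_comp_max_sub_of_gt h (hF _)
  exact hasDerivAt_twoSwitchResponse_of_hasDerivAt (hF t) (key a ha) (key c hc)

/-- The half-width of the middle arc of a symmetric two-switch control with no residual
excitation. -/
lemma exists_pos_sin_add_two_mul_eq (δ : ℝ) : ∃ b : ℝ, 0 < b ∧ sin (δ + 2 * b) = 2 * sin b := by
  have hle : π / 2 ≤ π / 2 + π := by linarith [pi_pos]
  have hcont : ContinuousOn (fun b => sin (δ + 2 * b) - 2 * sin b)
      (Set.Icc (π / 2) (π / 2 + π)) := by fun_prop
  obtain ⟨b, hb, h⟩ := intermediate_value_Icc hle hcont (show (0 : ℝ) ∈ Set.Icc _ _ by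
    simp only [sin_add_pi, sin_pi_div_two]
    exact ⟨by linarith [sin_le_one (δ + 2 * (π / 2))],
      by linarith [neg_one_le_sin (δ + 2 * (π / 2 + π))]⟩)
  exact ⟨b, by linarith [hb.1, pi_pos], sub_eq_zero.1 h⟩

/-- Controllability: for every `γ > 0` some piecewise-constant (bang-bang) control with values
in `{−1, 1}` transfers the system `ẋ₁ = x₂, ẋ₂ = x₃ − x₁, ẋ₃ = u` from the origin to
`(γ, 0, γ)` in some finite time `T > 0`. -/
theorem bang_bang_controllability
    (γ : ℝ) (hγ : 0 < γ) :
    ∃ (T : ℝ) (n : ℕ) (ts : ℕ → ℝ) (x₁ x₂ x₃ : ℝ → ℝ),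
      0 < T ∧ 1 ≤ n ∧ ts 0 = 0 ∧ ts n = T ∧
      (∀ j : ℕ, j < n → ts j < ts (j + 1)) ∧
      ContinuousOn x₁ (Set.Icc 0 T) ∧
      ContinuousOn x₂ (Set.Icc 0 T) ∧
      ContinuousOn x₃ (Set.Icc 0 T) ∧
      x₁ 0 = 0 ∧ x₂ 0 = 0 ∧ x₃ 0 = 0 ∧
      (∀ j : ℕ, 1 ≤ j → j ≤ n → ∀ t ∈ Set.Ioo (ts (j - 1)) (ts j),
        HasDerivAt x₁ (x₂ t) t ∧ HasDerivAt x₂ (x₃ t - x₁ t) t ∧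
          HasDerivAt x₃ ((-1 : ℝ) ^ (j - 1)) t) ∧
      x₁ T = γ ∧ x₂ T = 0 ∧ x₃ T = γ := by
  obtain ⟨b, hb, hsin⟩ := exists_pos_sin_add_two_mul_eq (γ / 2)
  obtain ⟨s, hs⟩ : ∃ s, s = γ / 2 + 2 * b := ⟨_, rfl⟩
  rw [← hs] at hsin
  have ha : 0 < s - b := by linarith
  have hac : s - b < s + b := by linarith
  have hcT : s + b < 2 * s := by linarith
  have d1 (t : ℝ) : HasDerivAt (fun t => t - sin t) (1 - cos t) t :=
    (hasDerivAt_id t).sub (hasDerivAt_sin t)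
  have d2 (t : ℝ) : HasDerivAt (fun t => 1 - cos t) (sin t) t := by
    simpa using (hasDerivAt_cos t).const_sub 1
  have hTa : max (2 * s - (s - b)) 0 = s + b := by rw [max_eq_left] <;> linarith
  have hTc : max (2 * s - (s + b)) 0 = s - b := by rw [max_eq_left] <;> linarith
  have h0a : max (0 - (s - b)) 0 = 0 := max_eq_right (by linarith)
  have h0c : max (0 - (s + b)) 0 = 0 := max_eq_right (by linarith)
  have away (t : ℝ) (hta : t ≠ s - b) (htc : t ≠ s + b) (u : ℝ)
      (h3 : HasDerivAt (twoSwitchResponse (fun t => t) (s - b) (s + b)) u t) :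
      HasDerivAt (twoSwitchResponse (fun t => t - sin t) (s - b) (s + b))
          (twoSwitchResponse (fun t => 1 - cos t) (s - b) (s + b) t) t ∧
        HasDerivAt (twoSwitchResponse (fun t => 1 - cos t) (s - b) (s + b))
          (twoSwitchResponse (fun t => t) (s - b) (s + b) t -
            twoSwitchResponse (fun t => t - sin t) (s - b) (s + b) t) t ∧
        HasDerivAt (twoSwitchResponse (fun t => t) (s - b) (s + b)) u t := by
    refine ⟨hasDerivAt_twoSwitchResponse d1 (by simp) hta htc, ?_, h3⟩
    convert hasDerivAt_twoSwitchResponse d2 sin_zero hta htc using 1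
    simp only [twoSwitchResponse]
    ring
  refine ⟨2 * s, 3, fun j => if j = 0 then 0 else if j = 1 then s - b else
    if j = 2 then s + b else 2 * s,
    twoSwitchResponse (fun t => t - sin t) (s - b) (s + b),
    twoSwitchResponse (fun t => 1 - cos t) (s - b) (s + b),
    twoSwitchResponse (fun t => t) (s - b) (s + b),
    by linarith, by norm_num, by simp, by simp, ?_,
    (continuous_twoSwitchResponse (by fun_prop) _ _).continuousOn,
    (continuous_twoSwitchResponse (by fun_prop) _ _).continuousOn,
    (continuous_twoSwitchResponse (by fun_prop) _ _).continuousOn,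
    ?_, ?_, ?_, ?_, ?_, ?_, ?_⟩
  · intro j hj
    interval_cases j <;> simp <;> linarith
  · simp only [twoSwitchResponse, h0a, h0c]; simp
  · simp only [twoSwitchResponse, h0a, h0c]; simp
  · simp only [twoSwitchResponse, h0a, h0c]; simp
  · intro j hj1 hj3 t ht
    interval_cases j
    · obtain ⟨-, h2⟩ : 0 < t ∧ t < s - b := by simpa using ht
      have h3 : t < s + b := by linarith
      refine away t h2.ne h3.ne _ ?_
      exact (hasDerivAt_twoSwitchResponse_of_hasDerivAt (hasDerivAt_id' t)
        (hasDerivAt_comp_max_sub_of_lt (fun x => x) h2)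
        (hasDerivAt_comp_max_sub_of_lt (fun x => x) h3)).congr_deriv (by norm_num)
    · obtain ⟨h2, h3⟩ : s - b < t ∧ t < s + b := by simpa using ht
      refine away t h2.ne' h3.ne _ ?_
      exact (hasDerivAt_twoSwitchResponse_of_hasDerivAt (hasDerivAt_id' t)
        (hasDerivAt_comp_max_sub_of_gt h2 (hasDerivAt_id' _))
        (hasDerivAt_comp_max_sub_of_lt (fun x => x) h3)).congr_deriv (by norm_num)
    · obtain ⟨h3, -⟩ : s + b < t ∧ t < 2 * s := by simpa using ht
      have h2 : s - b < t := by linarith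
      refine away t h2.ne' h3.ne' _ ?_
      exact (hasDerivAt_twoSwitchResponse_of_hasDerivAt (hasDerivAt_id' t)
        (hasDerivAt_comp_max_sub_of_gt h2 (hasDerivAt_id' _))
        (hasDerivAt_comp_max_sub_of_gt h3 (hasDerivAt_id' _))).congr_deriv (by norm_num)
  · simp only [twoSwitchResponse, hTa, hTc, sin_add, sin_sub, sin_two_mul, hsin]
    linarith
  · simp only [twoSwitchResponse, hTa, hTc, cos_add, cos_sub, cos_two_mul, cos_sq', hsin]
    ring
  · simp only [twoSwitchResponse, hTa, hTc]
    linarith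
end

section
/- Fix γ̄ ∈ (0, 2π). For each integer ρ ≥ 1, let τ_ρ ∈ (0, π) be the unique solution of (τ − γ̄/2)/(2ρ − 1) = arctan(sin τ/(2ρ − cos τ)), and let τ_∞ ∈ (0, π) be the unique solution of τ − sin τ = γ̄/2. Then τ_ρ → τ_∞ as ρ → ∞, and the shifted minimum transfer times converge: (4ρ·τ_ρ − γ̄)/(2ρ − 1) → 2·τ_∞ as ρ → ∞. -/
open Real Filter

theorem strictMono_sub_sin : StrictMono fun x : ℝ => x - Real.sin x := by
  intro a b hab
  have h1 : |Real.sin ((b - a) / 2)| < |(b - a) / 2| := abs_sin_lt_abs (by linarith)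
  rw [abs_of_pos (show 0 < (b - a) / 2 by linarith)] at h1
  have h2 := Real.sin_sub_sin b a
  have h3 : Real.sin ((b - a) / 2) * Real.cos ((b + a) / 2) ≤ |Real.sin ((b - a) / 2)| := by
    refine (le_abs_self _).trans ?_
    rw [abs_mul]
    exact mul_le_of_le_one_right (abs_nonneg _) (Real.abs_cos_le_one _)
  simp only
  linarith

theorem StrictMono.tendsto_of_tendsto_comp {ι α β : Type*} [LinearOrder α] [TopologicalSpace α]
    [OrderTopology α] [LinearOrder β] [TopologicalSpace β] [OrderTopology β] {g : α → β}
    (hg : StrictMono g) {l : Filter ι} {u : ι → α} {a : α}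
    (h : Tendsto (fun i => g (u i)) l (nhds (g a))) : Tendsto u l (nhds a) := by
  rw [tendsto_order] at h ⊢
  exact ⟨fun b hb => (h.1 _ (hg hb)).mono fun _ hi => hg.lt_iff_lt.1 hi,
    fun b hb => (h.2 _ (hg hb)).mono fun _ hi => hg.lt_iff_lt.1 hi⟩

theorem tendsto_inv_two_mul_sub_one :
    Tendsto (fun ρ : ℕ => (2 * (ρ : ℝ) - 1)⁻¹) atTop (nhds 0) := by
  refine tendsto_inv_atTop_zero.comp (tendsto_atTop_add_const_right _ (-1) ?_)
  exact tendsto_natCast_atTop_atTop.const_mul_atTop two_pos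

/-- For any sequence of angles `t`, `(2ρ - 1) arctan (sin t / (2ρ - cos t)) - sin t → 0`. -/
theorem tendsto_mul_arctan_sub_sin (t : ℕ → ℝ) :
    Tendsto (fun ρ : ℕ => (2 * (ρ : ℝ) - 1) *
      Real.arctan (Real.sin (t ρ) / (2 * (ρ : ℝ) - Real.cos (t ρ))) - Real.sin (t ρ))
      atTop (nhds 0) := by
  let x : ℕ → ℝ := fun ρ => Real.sin (t ρ) / (2 * (ρ : ℝ) - Real.cos (t ρ))
  have hpos : ∀ ρ : ℕ, 1 ≤ ρ → 0 < 2 * (ρ : ℝ) - 1 ∧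
      2 * (ρ : ℝ) - 1 ≤ 2 * (ρ : ℝ) - Real.cos (t ρ) := fun ρ h => by
    have : (1 : ℝ) ≤ ρ := by exact_mod_cast h
    exact ⟨by linarith, by linarith [Real.cos_le_one (t ρ)]⟩
  have hx0 : Tendsto x atTop (nhds 0) := by
    refine squeeze_zero_norm' ?_ tendsto_inv_two_mul_sub_one
    filter_upwards [eventually_ge_atTop 1] with ρ h
    obtain ⟨h1, h2⟩ := hpos ρ h
    rw [Real.norm_eq_abs, abs_div, abs_of_pos (h1.trans_le h2), inv_eq_one_div]
    exact div_le_div₀ zero_le_one (Real.abs_sin_le_one _) h1 h2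
  have hslope : Tendsto (fun ρ => dslope Real.arctan 0 (x ρ)) atTop (nhds 1) := by
    have hc : ContinuousAt (dslope Real.arctan 0) 0 :=
      continuousAt_dslope_same.2 (Real.differentiableAt_arctan 0)
    have h := hc.tendsto.comp hx0
    simpa [Function.comp_def] using h
  have hmul : Tendsto (fun ρ => x ρ * (Real.cos (t ρ) - 1)) atTop (nhds 0) := by
    refine squeeze_zero_norm (a := fun ρ => ‖x ρ‖ * 2) (fun ρ => ?_) (by simpa using hx0.norm.mul_const 2)
    rw [norm_mul]
    gcongr
    rw [Real.norm_eq_abs, abs_le]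
    constructor <;> linarith [Real.cos_le_one (t ρ), Real.neg_one_le_cos (t ρ)]
  have hsin : Tendsto (fun ρ => Real.sin (t ρ) * (dslope Real.arctan 0 (x ρ) - 1))
      atTop (nhds 0) := by
    refine squeeze_zero_norm (a := fun ρ => ‖dslope Real.arctan 0 (x ρ) - 1‖) (fun ρ => ?_)
      (by simpa using (hslope.sub_const 1).norm)
    rw [norm_mul]
    exact mul_le_of_le_one_left (norm_nonneg _) (Real.abs_sin_le_one _)
  have hsum := (hmul.mul hslope).add hsin
  rw [zero_mul, zero_add] at hsum
  refine hsum.congr' ?_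
  filter_upwards [eventually_ge_atTop 1] with ρ h
  obtain ⟨h1, h2⟩ := hpos ρ h
  have harctan : Real.arctan (x ρ) = x ρ * dslope Real.arctan 0 (x ρ) := by
    simpa using (sub_smul_dslope Real.arctan 0 (x ρ)).symm
  have hs : Real.sin (t ρ) = x ρ * (2 * (ρ : ℝ) - Real.cos (t ρ)) :=
    (div_mul_cancel₀ _ (h1.trans_le h2).ne').symm
  change _ = (2 * (ρ : ℝ) - 1) * Real.arctan (x ρ) - Real.sin (t ρ)
  rw [harctan, hs]
  ring


open Real Filter

/-- As `ρ → ∞`, the solution `τ_ρ ∈ (0, π)` of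
`(τ − γ̄/2)/(2ρ−1) = arctan(sin τ/(2ρ − cos τ))` converges to the solution `τ_∞ ∈ (0, π)` of
`τ − sin τ = γ̄/2`, and the shifted minimum transfer time `(4ρ τ_ρ − γ̄)/(2ρ−1)` converges to
`2 τ_∞`. -/
theorem switching_times_limit
    (γb : ℝ) (hγb : γb ∈ Set.Ioo (0 : ℝ) (2 * π))
    (τ : ℕ → ℝ) (τinf : ℝ)
    (hτ : ∀ ρ : ℕ, 1 ≤ ρ →
      τ ρ ∈ Set.Ioo (0 : ℝ) π ∧
      (τ ρ - γb / 2) / (2 * (ρ : ℝ) - 1)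
        = Real.arctan (Real.sin (τ ρ) / (2 * (ρ : ℝ) - Real.cos (τ ρ))))
    (hτinf : τinf ∈ Set.Ioo (0 : ℝ) π ∧ τinf - Real.sin τinf = γb / 2) :
    Tendsto τ atTop (nhds τinf) ∧
    Tendsto (fun ρ : ℕ => (4 * (ρ : ℝ) * τ ρ - γb) / (2 * (ρ : ℝ) - 1))
      atTop (nhds (2 * τinf)) := by
  have hne : ∀ ρ : ℕ, 1 ≤ ρ → 2 * (ρ : ℝ) - 1 ≠ 0 := fun ρ h => by
    have : (1 : ℝ) ≤ ρ := by exact_mod_cast h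
    linarith
  have hlim : Tendsto τ atTop (nhds τinf) := by
    refine strictMono_sub_sin.tendsto_of_tendsto_comp ?_
    have h := (tendsto_mul_arctan_sub_sin τ).add_const (γb / 2)
    rw [zero_add, ← hτinf.2] at h
    refine h.congr' ?_
    filter_upwards [eventually_ge_atTop 1] with ρ hρ
    rw [← (hτ ρ hρ).2, mul_div_cancel₀ _ (hne ρ hρ), hτinf.2]
    ring
  refine ⟨hlim, ?_⟩
  have h := (hlim.const_mul 2).add
    (((hlim.const_mul 2).sub_const γb).mul tendsto_inv_two_mul_sub_one)
  rw [mul_zero, add_zero] at h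
  refine h.congr' ?_
  filter_upwards [eventually_ge_atTop 1] with ρ hρ
  have := hne ρ hρ
  field_simp
  ring
end

section
/- Let ρ ≥ 1 be an integer. Consider a partition 0 = t₀ < t₁ < ⋯ < t_{2ρ+1} = T with constant-control intervals τ_k = t_k − t_{k−1} ∈ (0, 2π) satisfying τ_k + τ_{k+1} = 2π for k = 2, …, 2ρ − 1, and suppose a continuous x : [0,T] → ℝ³ with x(0) = 0 satisfies on each interval (t_{j−1}, t_j) the equations x₁' = x₂, x₂' = x₃ − x₁, x₃' = (−1)^{j−1}, and reaches x(T) = (γ, 0, γ) for some γ ∈ (2(ρ−1)π, 2ρπ). Then the first and last intervals are equal, τ₁ = τ_{2ρ+1}, and τ_{2ρ} = (2τ₁ + 2(ρ − 1)π − γ)/(2ρ − 1). -/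
open Real

theorem eq_of_hasDerivAt_sub_eq_zero {f g f' : ℝ → ℝ} {a b : ℝ} (hab : a < b)
    (hf : ContinuousOn f (Set.Icc a b)) (hg : ContinuousOn g (Set.Icc a b))
    (hf' : ∀ t ∈ Set.Ioo a b, HasDerivAt f (f' t) t)
    (hg' : ∀ t ∈ Set.Ioo a b, HasDerivAt g (f' t) t) :
    f b - f a = g b - g a := by
  obtain ⟨c, -, hc⟩ := exists_hasDerivAt_eq_slope (fun t => f t - g t) (fun t => f' t - f' t)
    hab (hf.sub hg) fun t ht => (hf' t ht).sub (hg' t ht)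
  rw [sub_self, eq_comm, div_eq_zero_iff] at hc
  rcases hc with hc | hc <;> linarith

/-- Increments of `x₃` and of the rotated coordinates along an arc with constant control `u`. -/
theorem constant_control_increments {x₁ x₂ x₃ : ℝ → ℝ} {a b u : ℝ} (hab : a < b)
    (hc₁ : ContinuousOn x₁ (Set.Icc a b)) (hc₂ : ContinuousOn x₂ (Set.Icc a b))
    (hc₃ : ContinuousOn x₃ (Set.Icc a b))
    (hode : ∀ t ∈ Set.Ioo a b, HasDerivAt x₁ (x₂ t) t ∧ HasDerivAt x₂ (x₃ t - x₁ t) t ∧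
      HasDerivAt x₃ u t) :
    x₃ b - x₃ a = u * (b - a) ∧
    ((x₁ b - x₃ b) * cos b - x₂ b * sin b) - ((x₁ a - x₃ a) * cos a - x₂ a * sin a)
      = -u * (sin b - sin a) ∧
    ((x₁ b - x₃ b) * sin b + x₂ b * cos b) - ((x₁ a - x₃ a) * sin a + x₂ a * cos a)
      = u * (cos b - cos a) := by
  refine ⟨?_, ?_, ?_⟩
  · rw [mul_sub]
    refine eq_of_hasDerivAt_sub_eq_zero (g := fun t => u * t) (f' := fun _ => u) hab hc₃
      (by fun_prop) (fun t ht => (hode t ht).2.2) fun t _ => ?_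
    simpa using (hasDerivAt_id t).const_mul u
  · rw [mul_sub]
    refine eq_of_hasDerivAt_sub_eq_zero (f := fun t => (x₁ t - x₃ t) * cos t - x₂ t * sin t)
      (g := fun t => -u * sin t) (f' := fun t => -u * cos t) hab (by fun_prop) (by fun_prop)
      (fun t ht => ?_) fun t _ => (hasDerivAt_sin t).const_mul (-u)
    obtain ⟨h₁, h₂, h₃⟩ := hode t ht
    refine (((h₁.sub h₃).mul (hasDerivAt_cos t)).sub (h₂.mul (hasDerivAt_sin t))).congr_deriv ?_
    simp only [Pi.sub_apply]
    ring
  · rw [mul_sub]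
    refine eq_of_hasDerivAt_sub_eq_zero (f := fun t => (x₁ t - x₃ t) * sin t + x₂ t * cos t)
      (g := fun t => u * cos t) (f' := fun t => u * -sin t) hab (by fun_prop) (by fun_prop)
      (fun t ht => ?_) fun t _ => (hasDerivAt_cos t).const_mul u
    obtain ⟨h₁, h₂, h₃⟩ := hode t ht
    refine (((h₁.sub h₃).mul (hasDerivAt_sin t)).add (h₂.mul (hasDerivAt_cos t))).congr_deriv ?_
    simp only [Pi.sub_apply]
    ring

/-- The closing condition of a `2ρ`-switching trajectory forces equal end intervals. -/
theorem end_intervals_eq_of_closing {c s a r : ℝ} (hc : c ≠ 0)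
    (hs : s ∈ Set.Ioo 0 (2 * π)) (ha : a ∈ Set.Ioo 0 (2 * π)) (hr : r ∈ Set.Ioo 0 (2 * π))
    (hsin : c * (sin s - sin (s + a)) + sin (s + a + r) = 0)
    (hcos : c * (cos s - cos (s + a)) + cos (s + a + r) - 1 = 0) : s = r := by
  set A := (s + a + r) / 2 with hA
  have e₁ := cos_sub s A
  have e₂ := cos_sub (s + a) A
  have e₃ := cos_sub (s + a + r) A
  have e₄ : s + a + r - A = A := by rw [hA]; ring
  have e₅ : cos (s - A) - cos (s + a - A) = 2 * sin ((s - r) / 2) * sin (a / 2) := by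
    rw [cos_sub_cos, show (s - A + (s + a - A)) / 2 = (s - r) / 2 by rw [hA]; ring,
      show (s - A - (s + a - A)) / 2 = -(a / 2) by ring, sin_neg]
    ring
  rw [e₄] at e₃
  have key : c * (2 * sin ((s - r) / 2) * sin (a / 2)) = 0 := by
    rw [← e₅, e₁, e₂]
    linear_combination cos A * hcos + sin A * hsin + e₃
  have hsa : 0 < sin (a / 2) := sin_pos_of_pos_of_lt_pi (by linarith [ha.1]) (by linarith [ha.2])
  have hzero : sin ((s - r) / 2) = 0 := by
    simpa [hc, hsa.ne'] using key
  have := (sin_eq_zero_iff_of_lt_of_lt (by linarith [hs.1, hr.2]) (by linarith [hs.2, hr.1])).1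
    hzero
  linarith

/-- For a bang-bang trajectory with `2ρ` switchings whose intermediate constant-control
intervals pair up to `2π` and which transfers the system `ẋ₁ = x₂, ẋ₂ = x₃ − x₁,
ẋ₃ = (−1)^{j−1}` from the origin to `(γ, 0, γ)` with `2(ρ−1)π < γ < 2ρπ`, the first and last
intervals are equal, `τ₁ = τ_{2ρ+1}`, and `τ_{2ρ} = (2τ₁ + 2(ρ−1)π − γ)/(2ρ−1)`. -/
theorem first_eq_last_interval_and_tau2rho
    (ρ : ℕ) (hρ : 1 ≤ ρ) (T γ : ℝ)
    (hγ₁ : 2 * ((ρ : ℝ) - 1) * π < γ) (hγ₂ : γ < 2 * (ρ : ℝ) * π)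
    (ts : ℕ → ℝ) (ht0 : ts 0 = 0) (htT : ts (2 * ρ + 1) = T)
    (hτmem : ∀ k : ℕ, 1 ≤ k → k ≤ 2 * ρ + 1 →
      ts k - ts (k - 1) ∈ Set.Ioo (0 : ℝ) (2 * π))
    (hpair : ∀ k : ℕ, 2 ≤ k → k ≤ 2 * ρ - 1 →
      (ts k - ts (k - 1)) + (ts (k + 1) - ts k) = 2 * π)
    (x₁ x₂ x₃ : ℝ → ℝ)
    (hc₁ : ContinuousOn x₁ (Set.Icc 0 T))
    (hc₂ : ContinuousOn x₂ (Set.Icc 0 T))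
    (hc₃ : ContinuousOn x₃ (Set.Icc 0 T))
    (h0₁ : x₁ 0 = 0) (h0₂ : x₂ 0 = 0) (h0₃ : x₃ 0 = 0)
    (hode : ∀ j : ℕ, 1 ≤ j → j ≤ 2 * ρ + 1 → ∀ t ∈ Set.Ioo (ts (j - 1)) (ts j),
      HasDerivAt x₁ (x₂ t) t ∧ HasDerivAt x₂ (x₃ t - x₁ t) t ∧
        HasDerivAt x₃ ((-1 : ℝ) ^ (j - 1)) t)
    (hT₁ : x₁ T = γ) (hT₂ : x₂ T = 0) (hT₃ : x₃ T = γ) :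
    ts 1 - ts 0 = ts (2 * ρ + 1) - ts (2 * ρ) ∧
    ts (2 * ρ) - ts (2 * ρ - 1)
      = (2 * (ts 1 - ts 0) + 2 * ((ρ : ℝ) - 1) * π - γ) / (2 * (ρ : ℝ) - 1) := by
  have hlt : ∀ k, k ≤ 2 * ρ → ts k < ts (k + 1) := fun k hk => by
    have := (hτmem (k + 1) (by omega) (by omega)).1
    simpa using this
  have hnonneg : ∀ k, k ≤ 2 * ρ + 1 → 0 ≤ ts k := fun k => by
    induction k with
    | zero => intro _; exact ht0.ge
    | succ k ih => intro hk; linarith [ih (by omega), hlt k (by omega)]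
  have hle : ∀ d, d ≤ 2 * ρ + 1 → ts (2 * ρ + 1 - d) ≤ T := fun d => by
    induction d with
    | zero => intro _; exact htT.le
    | succ d ih =>
      intro hd
      have h := hlt (2 * ρ + 1 - (d + 1)) (by omega)
      rw [show 2 * ρ + 1 - (d + 1) + 1 = 2 * ρ + 1 - d by omega] at h
      linarith [ih (by omega)]
  have hinc : ∀ k, k ≤ 2 * ρ → _ := fun k hk => by
    have hsub : Set.Icc (ts k) (ts (k + 1)) ⊆ Set.Icc 0 T := by
      refine Set.Icc_subset_Icc (hnonneg k (by omega)) ?_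
      have h := hle (2 * ρ - k) (by omega)
      rwa [show 2 * ρ + 1 - (2 * ρ - k) = k + 1 by omega] at h
    exact constant_control_increments (u := (-1) ^ k) (hlt k hk) (hc₁.mono hsub) (hc₂.mono hsub)
      (hc₃.mono hsub) (hode (k + 1) (by omega) (by omega))
  have hstep : ∀ k, 1 ≤ k → k + 2 ≤ 2 * ρ → ts (k + 2) = ts k + 2 * π := fun k hk hk' => by
    have h := hpair (k + 1) (by omega) (by omega)
    rw [Nat.add_sub_cancel] at h
    linarith
  have hmain : ∀ m : ℕ, m + 1 ≤ ρ →
      ts (2 * m + 1) = ts 1 + m * (2 * π) ∧ ts (2 * m + 2) = ts 2 + m * (2 * π) ∧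
      x₃ (ts (2 * m + 2))
        = ts 1 + m * (2 * π) - (2 * m + 1) * (ts 2 - ts 1) ∧
      (x₁ (ts (2 * m + 2)) - x₃ (ts (2 * m + 2))) * cos (ts (2 * m + 2))
          - x₂ (ts (2 * m + 2)) * sin (ts (2 * m + 2))
        = -(2 * (m + 1) * (sin (ts 1) - sin (ts 2)) + sin (ts 2)) ∧
      (x₁ (ts (2 * m + 2)) - x₃ (ts (2 * m + 2))) * sin (ts (2 * m + 2))
          + x₂ (ts (2 * m + 2)) * cos (ts (2 * m + 2))
        = 2 * (m + 1) * (cos (ts 1) - cos (ts 2)) + cos (ts 2) - 1 := fun m => by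
    induction m with
    | zero =>
      intro _
      obtain ⟨a₁, a₂, a₃⟩ := hinc 0 (by omega)
      obtain ⟨b₁, b₂, b₃⟩ := hinc 1 (by omega)
      norm_num [ht0, h0₁, h0₂, h0₃] at a₁ a₂ a₃ b₁ b₂ b₃ ⊢
      refine ⟨?_, ?_, ?_⟩ <;> linarith
    | succ m ih =>
      intro hm
      obtain ⟨i₁, i₂, i₃, i₄, i₅⟩ := ih (by omega)
      obtain ⟨a₁, a₂, a₃⟩ := hinc (2 * m + 2) (by omega)
      obtain ⟨b₁, b₂, b₃⟩ := hinc (2 * m + 3) (by omega)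
      have s₁ : ts (2 * m + 3) = ts 1 + (m + 1 : ℕ) * (2 * π) := by
        rw [hstep (2 * m + 1) (by omega) (by omega), i₁]; push_cast; ring
      have s₂ : ts (2 * m + 4) = ts 2 + (m + 1 : ℕ) * (2 * π) := by
        rw [hstep (2 * m + 2) (by omega) (by omega), i₂]; push_cast; ring
      have p₂ : (-1 : ℝ) ^ (2 * m + 2) = 1 := Even.neg_one_pow ⟨m + 1, by ring⟩
      have p₃ : (-1 : ℝ) ^ (2 * m + 3) = -1 := Odd.neg_one_pow ⟨m + 1, by ring⟩
      have c₀ : cos (ts (2 * m + 2)) = cos (ts 2) := by rw [i₂, cos_add_nat_mul_two_pi]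
      have d₀ : sin (ts (2 * m + 2)) = sin (ts 2) := by rw [i₂, sin_add_nat_mul_two_pi]
      have c₁ : cos (ts (2 * m + 3)) = cos (ts 1) := by rw [s₁, cos_add_nat_mul_two_pi]
      have d₁ : sin (ts (2 * m + 3)) = sin (ts 1) := by rw [s₁, sin_add_nat_mul_two_pi]
      have c₂ : cos (ts (2 * m + 4)) = cos (ts 2) := by rw [s₂, cos_add_nat_mul_two_pi]
      have d₂ : sin (ts (2 * m + 4)) = sin (ts 2) := by rw [s₂, sin_add_nat_mul_two_pi]
      simp only [show 2 * m + 2 + 1 = 2 * m + 3 by ring, show 2 * m + 3 + 1 = 2 * m + 4 by ring,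
        show 2 * (m + 1) + 1 = 2 * m + 3 by ring, show 2 * (m + 1) + 2 = 2 * m + 4 by ring,
        p₂, p₃, c₀, d₀, c₁, d₁, c₂, d₂] at *
      refine ⟨s₁, s₂, ?_, ?_, ?_⟩
      · push_cast at s₁ s₂ ⊢
        linear_combination a₁ + b₁ + i₃ + 2 * s₁ - s₂ - i₂
      · push_cast; linarith
      · push_cast; linarith
  obtain ⟨n, rfl⟩ : ∃ n, ρ = n + 1 := ⟨ρ - 1, by omega⟩
  obtain ⟨i₁, i₂, i₃, i₄, i₅⟩ := hmain n le_rfl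
  obtain ⟨a₁, a₂, a₃⟩ := hinc (2 * n + 2) (by omega)
  have p₂ : (-1 : ℝ) ^ (2 * n + 2) = 1 := Even.neg_one_pow ⟨n + 1, by ring⟩
  have m₁ := hτmem 1 le_rfl (by omega)
  have m₂ := hτmem 2 (by omega) (by omega)
  have m₃ := hτmem (2 * n + 3) (by omega) (by omega)
  simp only [show 2 * n + 2 + 1 = 2 * n + 3 by ring,
    show 2 * (n + 1) = 2 * n + 2 by ring, show 2 * n + 2 - 1 = 2 * n + 1 by omega,
    show 2 * n + 3 - 1 = 2 * n + 2 by omega, Nat.sub_self, Nat.reduceSub, ht0, sub_zero]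
    at htT m₁ m₂ m₃ a₁ a₂ a₃ ⊢
  rw [p₂, htT, hT₁, hT₂, hT₃] at a₂ a₃
  rw [p₂, htT, hT₃] at a₁
  rw [htT] at m₃ ⊢
  have hT : T = ts 1 + (ts 2 - ts 1) + (T - ts (2 * n + 2)) + n * (2 * π) := by
    rw [i₂]; ring
  have hsinT : sin (ts 1 + (ts 2 - ts 1) + (T - ts (2 * n + 2))) = sin T := by
    conv_rhs => rw [hT, sin_add_nat_mul_two_pi]
  have hcosT : cos (ts 1 + (ts 2 - ts 1) + (T - ts (2 * n + 2))) = cos T := by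
    conv_rhs => rw [hT, cos_add_nat_mul_two_pi]
  have hs2 : sin (ts (2 * n + 2)) = sin (ts 2) := by rw [i₂, sin_add_nat_mul_two_pi]
  have hc2 : cos (ts (2 * n + 2)) = cos (ts 2) := by rw [i₂, cos_add_nat_mul_two_pi]
  have heq : ts 1 = T - ts (2 * n + 2) := by
    refine end_intervals_eq_of_closing (c := 2 * (n + 1)) (a := ts 2 - ts 1) (by positivity)
      m₁ m₂ m₃ ?_ ?_
    · rw [hsinT, add_sub_cancel]
      linear_combination a₂ + i₄ + hs2
    · rw [hcosT, add_sub_cancel]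
      linear_combination -a₃ - i₅ + hc2
  refine ⟨heq, ?_⟩
  have hn : 2 * ((n + 1 : ℕ) : ℝ) - 1 ≠ 0 := by
    push_cast
    have : (0 : ℝ) ≤ n := n.cast_nonneg
    linarith
  rw [eq_div_iff hn, i₁, i₂]
  push_cast
  linear_combination a₁ + i₃ - heq
end
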